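/- For all nonzero vectors a, b in H, the function f : [0,1] → ℝ defined by f(q) = ω_q(a⊗b) attains its minimum over [0,1] at an endpoint; that is, for every q ∈ [0,1], f(q) ≥ min(f(0), f(1)). -/

import Mathlib

open scoped ComplexInnerProductSpace

/-- The rank-one operator `a ⊗ b` on a complex Hilbert space, acting by
`(a ⊗ b) x = ⟨x, a⟩ · b` (i.e. `x ↦ ⟪a, x⟫ • b` in Mathlib's convention, where the
inner product is conjugate-linear in the first slot). -/
noncomputable def rankOne {H : Type*} [NormedAddCommGroup H] [InnerProductSpace ℂ H]
    (a b : H) : H →L[ℂ] H :=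
  (innerSL ℂ a).smulRight b

/-- The `q`-numerical radius `ω_q(A) = sup { |⟨Ax, y⟩| : ‖x‖ = ‖y‖ = 1, ⟨x, y⟩ = q }`. -/
noncomputable def qRad {H : Type*} [NormedAddCommGroup H] [InnerProductSpace ℂ H]
    (q : ℝ) (A : H →L[ℂ] H) : ℝ :=
  sSup {r : ℝ | ∃ x y : H, ‖x‖ = 1 ∧ ‖y‖ = 1 ∧ ⟪x, y⟫ = (q : ℂ) ∧ r = ‖⟪A x, y⟫‖}

section

variable {H : Type*} [NormedAddCommGroup H] [InnerProductSpace ℂ H]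

theorem norm_inner_rankOne (a b x y : H) :
    ‖⟪rankOne a b x, y⟫‖ = ‖⟪a, x⟫‖ * ‖⟪b, y⟫‖ := by
  rw [norm_inner_symm a x]
  simp [rankOne, mul_comm]

/-- Buzano's inequality for unit vectors. -/
theorem two_mul_norm_inner_mul_norm_inner_le {a b x : H} (ha : ‖a‖ = 1) (hb : ‖b‖ = 1)
    (hx : ‖x‖ = 1) : 2 * (‖⟪a, x⟫‖ * ‖⟪b, x⟫‖) ≤ 1 + ‖⟪a, b⟫‖ := by
  have hcs := norm_inner_le_norm (𝕜 := ℂ) ((ℂ ∙ x).reflection a) b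
  rw [LinearIsometryEquiv.norm_map, ha, hb, one_mul, Submodule.reflection_singleton_apply] at hcs
  have heq : 2 * (⟪a, x⟫ * ⟪x, b⟫) =
      ⟪2 • (⟪x, a⟫ / ((‖x‖ : ℂ) ^ 2)) • x - a, b⟫ + ⟪a, b⟫ := by
    simp [hx, two_smul]
    ring
  calc 2 * (‖⟪a, x⟫‖ * ‖⟪b, x⟫‖) = ‖2 * (⟪a, x⟫ * ⟪x, b⟫)‖ := by
        rw [norm_mul, norm_mul, norm_inner_symm x b]; simp
    _ ≤ _ := by
        rw [heq]
        exact (norm_add_le _ _).trans (add_le_add_left hcs _)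

theorem norm_sub_inner_smul_sq {a b : H} (ha : ‖a‖ = 1) (hb : ‖b‖ = 1) :
    ‖b - ⟪a, b⟫ • a‖ ^ 2 = 1 - ‖⟪a, b⟫‖ ^ 2 := by
  have horth : ⟪⟪a, b⟫ • a, b - ⟪a, b⟫ • a⟫ = 0 := by
    rw [inner_smul_left, inner_sub_right, inner_smul_right, inner_self_eq_norm_sq_to_K, ha]
    simp
  have h := norm_add_sq_eq_norm_sq_add_norm_sq_of_inner_eq_zero _ _ horth
  rw [add_sub_cancel, norm_smul, ha, hb] at h
  linarith

theorem norm_inner_sq_add_norm_inner_sq_le {x y : H} (hx : ‖x‖ = 1) (hy : ‖y‖ = 1)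
    (hxy : ⟪x, y⟫ = 0) (v : H) : ‖⟪x, v⟫‖ ^ 2 + ‖⟪y, v⟫‖ ^ 2 ≤ ‖v‖ ^ 2 := by
  have ho : Orthonormal ℂ ![x, y] := by
    simp [orthonormal_vecCons_iff, hx, hy, hxy]
  simpa [Fin.sum_univ_two] using ho.sum_inner_products_le v (s := Finset.univ)

/-- The analogue of Buzano's inequality for a pair of orthogonal unit vectors. -/
theorem two_mul_norm_inner_mul_norm_inner_le_of_orthogonal {a b x y : H} (ha : ‖a‖ = 1)
    (hb : ‖b‖ = 1) (hx : ‖x‖ = 1) (hy : ‖y‖ = 1) (hxy : ⟪x, y⟫ = 0) :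
    2 * (‖⟪a, x⟫‖ * ‖⟪b, y⟫‖) ≤ 1 + √(1 - ‖⟪a, b⟫‖ ^ 2) := by
  have hA := norm_inner_sq_add_norm_inner_sq_le hx hy hxy a
  have hB := norm_inner_sq_add_norm_inner_sq_le hx hy hxy b
  rw [ha, norm_inner_symm x, norm_inner_symm y] at hA
  rw [hb, norm_inner_symm x, norm_inner_symm y] at hB
  have hsum : ‖⟪a, x⟫ * ⟪b, y⟫ + ⟪a, y⟫ * ⟪b, x⟫‖ ≤ 1 := by
    refine (norm_add_le _ _).trans ?_
    rw [norm_mul, norm_mul]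
    nlinarith [sq_nonneg (‖⟪a, x⟫‖ - ‖⟪b, y⟫‖), sq_nonneg (‖⟪a, y⟫‖ - ‖⟪b, x⟫‖)]
  set z : H := ⟪b, y⟫ • x - ⟪b, x⟫ • y with hz
  have hznorm : ‖z‖ ≤ 1 := by
    have horth : ⟪⟪b, y⟫ • x, ⟪b, x⟫ • y⟫ = 0 := by
      simp [hxy]
    have h := norm_sub_sq (𝕜 := ℂ) (⟪b, y⟫ • x) (⟪b, x⟫ • y)
    rw [horth, ← hz, map_zero, norm_smul, norm_smul, hx, hy] at h
    nlinarith [norm_nonneg z]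
  have hdiff : ⟪a, x⟫ * ⟪b, y⟫ - ⟪a, y⟫ * ⟪b, x⟫ = ⟪a - ⟪b, a⟫ • b, z⟫ := by
    simp [hz]
    ring
  have hD : ‖⟪a, x⟫ * ⟪b, y⟫ - ⟪a, y⟫ * ⟪b, x⟫‖ ≤ √(1 - ‖⟪a, b⟫‖ ^ 2) := by
    rw [hdiff, norm_inner_symm a b, ← norm_sub_inner_smul_sq hb ha,
      Real.sqrt_sq (norm_nonneg _)]
    exact (norm_inner_le_norm _ _).trans (mul_le_of_le_one_right (norm_nonneg _) hznorm)
  calc 2 * (‖⟪a, x⟫‖ * ‖⟪b, y⟫‖) = ‖(2 : ℂ) * (⟪a, x⟫ * ⟪b, y⟫)‖ := by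
        rw [norm_mul, norm_mul]; simp
    _ = ‖(⟪a, x⟫ * ⟪b, y⟫ + ⟪a, y⟫ * ⟪b, x⟫) + (⟪a, x⟫ * ⟪b, y⟫ - ⟪a, y⟫ * ⟪b, x⟫)‖ := by
        congr 1; ring
    _ ≤ _ := (norm_add_le _ _).trans (add_le_add hsum hD)

theorem exists_norm_eq_one_inner_eq_zero (hdim : 2 ≤ Module.rank ℂ H) (a : H) :
    ∃ e : H, ‖e‖ = 1 ∧ ⟪a, e⟫ = 0 := by
  have h : (ℂ ∙ a)ᗮ ≠ ⊥ := by
    intro h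
    rw [Submodule.orthogonal_eq_bot_iff] at h
    have := rank_span_le (R := ℂ) ({a} : Set H)
    rw [h, rank_top, Cardinal.mk_singleton] at this
    exact absurd (hdim.trans this) (by norm_num)
  obtain ⟨v, hv, hv0⟩ := Submodule.exists_mem_ne_zero_of_ne_bot h
  rw [Submodule.mem_orthogonal_singleton_iff_inner_right] at hv
  exact ⟨(‖v‖⁻¹ : ℂ) • v, norm_smul_inv_norm hv0, by rw [inner_smul_right, hv, mul_zero]⟩

theorem exists_eq_inner_smul_add_sqrt_smul (hdim : 2 ≤ Module.rank ℂ H) {a b : H}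
    (ha : ‖a‖ = 1) (hb : ‖b‖ = 1) :
    ∃ e : H, ‖e‖ = 1 ∧ ⟪a, e⟫ = 0 ∧
      b = ⟪a, b⟫ • a + ((√(1 - ‖⟪a, b⟫‖ ^ 2) : ℝ) : ℂ) • e := by
  rw [← norm_sub_inner_smul_sq ha hb, Real.sqrt_sq (norm_nonneg _)]
  set w := b - ⟪a, b⟫ • a with hw
  by_cases hw0 : w = 0
  · obtain ⟨e, he, hae⟩ := exists_norm_eq_one_inner_eq_zero hdim a
    refine ⟨e, he, hae, ?_⟩
    rw [hw0, norm_zero, Complex.ofReal_zero, zero_smul, add_zero]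
    exact sub_eq_zero.mp hw0
  · refine ⟨(‖w‖⁻¹ : ℂ) • w, norm_smul_inv_norm hw0, ?_, ?_⟩
    · simp [hw, inner_self_eq_norm_sq_to_K, ha]
    · rw [smul_smul, mul_inv_cancel₀ (by simpa using hw0), one_smul, hw, add_sub_cancel]

theorem inner_smul_add_smul_of_orthogonal {a e : H} (ha : ‖a‖ = 1) (he : ‖e‖ = 1)
    (hae : ⟪a, e⟫ = 0) (p r p' r' : ℝ) :
    ⟪(p : ℂ) • a + (r : ℂ) • e, (p' : ℂ) • a + (r' : ℂ) • e⟫ = ((p * p' + r * r' : ℝ) : ℂ) := by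
  have hea : ⟪e, a⟫ = 0 := inner_eq_zero_symm.mp hae
  simp [hae, hea, inner_self_eq_norm_sq_to_K, ha, he]
  ring

theorem exists_norm_inner_mul_norm_inner_eq (hdim : 2 ≤ Module.rank ℂ H) {a b : H}
    (ha : ‖a‖ = 1) (hb : ‖b‖ = 1) {q : ℝ} (hq : q ∈ Set.Icc (0 : ℝ) 1) :
    ∃ x y : H, ‖x‖ = 1 ∧ ‖y‖ = 1 ∧ ⟪x, y⟫ = (q : ℂ) ∧
      2 * (‖⟪a, x⟫‖ * ‖⟪b, y⟫‖) =
        1 + ‖⟪a, b⟫‖ * q + √(1 - ‖⟪a, b⟫‖ ^ 2) * √(1 - q ^ 2) := by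
  obtain ⟨e₀, he₀, hae₀, hbe₀⟩ := exists_eq_inner_smul_add_sqrt_smul hdim ha hb
  have ht1 : ‖⟪a, b⟫‖ ≤ 1 := by simpa [ha, hb] using norm_inner_le_norm (𝕜 := ℂ) a b
  set u : ℂ := Complex.exp (Complex.arg ⟪a, b⟫ * Complex.I) with hu
  have hu1 : ‖u‖ = 1 := Complex.norm_exp_ofReal_mul_I _
  have hut : (‖⟪a, b⟫‖ : ℂ) * u = ⟪a, b⟫ := Complex.norm_mul_exp_arg_mul_I _
  have hu0 : u ≠ 0 := Complex.exp_ne_zero _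
  generalize htdef : ‖⟪a, b⟫‖ = t at *
  have ht0 : 0 ≤ t := htdef ▸ norm_nonneg _
  set e : H := u⁻¹ • e₀ with he_def
  have he : ‖e‖ = 1 := by rw [he_def, norm_smul, norm_inv, hu1, he₀]; norm_num
  have hae : ⟪a, e⟫ = 0 := by rw [he_def, inner_smul_right, hae₀, mul_zero]
  set θ := Real.arccos t with hθ
  set φ := Real.arccos q with hφ
  have hcθ : Real.cos θ = t := Real.cos_arccos (by linarith) ht1
  have hsθ : Real.sin θ = √(1 - t ^ 2) := Real.sin_arccos t
  have hcφ : Real.cos φ = q := Real.cos_arccos (by linarith [hq.1]) hq.2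
  have hsφ : Real.sin φ = √(1 - q ^ 2) := Real.sin_arccos q
  have hbu : b = u • ((Real.cos θ : ℂ) • a + (Real.sin θ : ℂ) • e) := by
    have hue : u • e = e₀ := by rw [he_def, smul_smul, mul_inv_cancel₀ hu0, one_smul]
    rw [smul_add, smul_smul, smul_comm u _ e, hue, hcθ, hsθ, mul_comm u, hut]
    exact hbe₀
  have hnorm (α : ℝ) : ‖(Real.cos α : ℂ) • a + (Real.sin α : ℂ) • e‖ = 1 := by
    refine (pow_eq_one_iff_of_nonneg (norm_nonneg _) two_ne_zero).mp ?_
    rw [norm_sq_eq_re_inner (𝕜 := ℂ), inner_smul_add_smul_of_orthogonal ha he hae, ← sq, ← sq,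
      Real.cos_sq_add_sin_sq]
    simp
  have hinner (α β : ℝ) : ⟪(Real.cos α : ℂ) • a + (Real.sin α : ℂ) • e,
      (Real.cos β : ℂ) • a + (Real.sin β : ℂ) • e⟫ = (Real.cos (α - β) : ℂ) := by
    rw [inner_smul_add_smul_of_orthogonal ha he hae, Real.cos_sub]
  have hax : ⟪a, (Real.cos ((θ - φ) / 2) : ℂ) • a + (Real.sin ((θ - φ) / 2) : ℂ) • e⟫ =
      (Real.cos ((θ - φ) / 2) : ℂ) := by
    have h := hinner 0 ((θ - φ) / 2)
    rwa [Real.cos_zero, Real.sin_zero, Complex.ofReal_one, Complex.ofReal_zero, one_smul,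
      zero_smul, add_zero, zero_sub, Real.cos_neg] at h
  refine ⟨(Real.cos ((θ - φ) / 2) : ℂ) • a + (Real.sin ((θ - φ) / 2) : ℂ) • e,
    (Real.cos ((θ + φ) / 2) : ℂ) • a + (Real.sin ((θ + φ) / 2) : ℂ) • e,
    hnorm _, hnorm _, ?_, ?_⟩
  · rw [hinner, show (θ - φ) / 2 - (θ + φ) / 2 = -φ by ring, Real.cos_neg, hcφ]
  · rw [hax, hbu, inner_smul_left, hinner, show θ - (θ + φ) / 2 = (θ - φ) / 2 by ring, norm_mul,
      RCLike.norm_conj, hu1, one_mul, Complex.norm_real, ← norm_mul, ← sq,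
      Real.norm_of_nonneg (sq_nonneg _), Real.cos_sq, mul_div_cancel₀ _ two_ne_zero, Real.cos_sub,
      hcθ, hsθ, hcφ, hsφ]
    ring

theorem bddAbove_qRad (q : ℝ) (A : H →L[ℂ] H) :
    BddAbove {r : ℝ | ∃ x y : H, ‖x‖ = 1 ∧ ‖y‖ = 1 ∧ ⟪x, y⟫ = (q : ℂ) ∧ r = ‖⟪A x, y⟫‖} := by
  refine ⟨‖A‖, ?_⟩
  rintro _ ⟨x, y, hx, hy, -, rfl⟩
  simpa [hx, hy] using (norm_inner_le_norm (A x) y).trans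
    (mul_le_mul_of_nonneg_right (A.le_opNorm x) (norm_nonneg y))

theorem qRad_rankOne_smul {α β : ℝ} (hα : 0 ≤ α) (hβ : 0 ≤ β) (q : ℝ) (a b : H) :
    qRad q (rankOne ((α : ℂ) • a) ((β : ℂ) • b)) = α * β * qRad q (rankOne a b) := by
  rw [qRad, qRad, ← smul_eq_mul, ← Real.sSup_smul_of_nonneg (mul_nonneg hα hβ)]
  congr 1
  ext r
  simp only [norm_inner_rankOne, inner_smul_left, norm_mul, Complex.conj_ofReal,
    Complex.norm_real, Real.norm_of_nonneg hα, Real.norm_of_nonneg hβ, Set.mem_smul_set,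
    Set.mem_ofPred_eq, smul_eq_mul]
  constructor
  · rintro ⟨x, y, hx, hy, hxy, rfl⟩
    exact ⟨_, ⟨x, y, hx, hy, hxy, rfl⟩, by ring⟩
  · rintro ⟨_, ⟨x, y, hx, hy, hxy, rfl⟩, rfl⟩
    exact ⟨x, y, hx, hy, hxy, by ring⟩

theorem qRad_one_rankOne_le {a b : H} (ha : ‖a‖ = 1) (hb : ‖b‖ = 1) :
    qRad 1 (rankOne a b) ≤ (1 + ‖⟪a, b⟫‖) / 2 := by
  refine Real.sSup_le ?_ (by positivity)
  rintro _ ⟨x, y, hx, hy, hxy, rfl⟩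
  rw [Complex.ofReal_one, inner_eq_one_iff_of_norm_eq_one hx hy] at hxy
  subst hxy
  rw [norm_inner_rankOne]
  linarith [two_mul_norm_inner_mul_norm_inner_le ha hb hx]

theorem qRad_zero_rankOne_le {a b : H} (ha : ‖a‖ = 1) (hb : ‖b‖ = 1) :
    qRad 0 (rankOne a b) ≤ (1 + √(1 - ‖⟪a, b⟫‖ ^ 2)) / 2 := by
  refine Real.sSup_le ?_ (by positivity)
  rintro _ ⟨x, y, hx, hy, hxy, rfl⟩
  rw [Complex.ofReal_zero] at hxy
  rw [norm_inner_rankOne]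
  linarith [two_mul_norm_inner_mul_norm_inner_le_of_orthogonal ha hb hx hy hxy]

theorem le_qRad_rankOne (hdim : 2 ≤ Module.rank ℂ H) {a b : H} (ha : ‖a‖ = 1) (hb : ‖b‖ = 1)
    {q : ℝ} (hq : q ∈ Set.Icc (0 : ℝ) 1) :
    (1 + ‖⟪a, b⟫‖ * q + √(1 - ‖⟪a, b⟫‖ ^ 2) * √(1 - q ^ 2)) / 2 ≤ qRad q (rankOne a b) := by
  obtain ⟨x, y, hx, hy, hxy, h⟩ := exists_norm_inner_mul_norm_inner_eq hdim ha hb hq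
  rw [← h, mul_div_cancel_left₀ _ two_ne_zero, ← norm_inner_rankOne]
  exact le_csSup (bddAbove_qRad q _) ⟨x, y, hx, hy, hxy, rfl⟩

theorem min_qRad_rankOne_le_of_norm_eq_one (hdim : 2 ≤ Module.rank ℂ H) {a b : H} (ha : ‖a‖ = 1)
    (hb : ‖b‖ = 1) {q : ℝ} (hq : q ∈ Set.Icc (0 : ℝ) 1) :
    min (qRad 0 (rankOne a b)) (qRad 1 (rankOne a b)) ≤ qRad q (rankOne a b) := by
  have h0 := qRad_zero_rankOne_le ha hb
  have h1 := qRad_one_rankOne_le ha hb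
  have hl := le_qRad_rankOne hdim ha hb hq
  have ht : 0 ≤ ‖⟪a, b⟫‖ := norm_nonneg _
  have hs : 0 ≤ √(1 - ‖⟪a, b⟫‖ ^ 2) := Real.sqrt_nonneg _
  have hq' : 1 - q ≤ √(1 - q ^ 2) := by
    apply Real.le_sqrt_of_sq_le
    nlinarith [hq.1, hq.2]
  generalize √(1 - ‖⟪a, b⟫‖ ^ 2) = s at *
  generalize ‖⟪a, b⟫‖ = t at *
  have hsq := mul_le_mul_of_nonneg_left hq' hs
  rcases le_total t s with hts | hst
  · refine (min_le_right _ _).trans ?_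
    nlinarith [mul_nonneg (sub_nonneg.mpr hts) (sub_nonneg.mpr hq.2)]
  · refine (min_le_left _ _).trans ?_
    nlinarith [mul_nonneg (sub_nonneg.mpr hst) hq.1]

end

/-- The function `q ↦ ω_q(a ⊗ b)` attains its minimum over `[0, 1]` at an endpoint. -/
theorem stmt10 {H : Type*} [NormedAddCommGroup H] [InnerProductSpace ℂ H] [CompleteSpace H]
    (hdim : 2 ≤ Module.rank ℂ H) (a b : H) (ha : a ≠ 0) (hb : b ≠ 0)
    (q : ℝ) (hq : q ∈ Set.Icc (0 : ℝ) 1) :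
    qRad q (rankOne a b) ≥ min (qRad 0 (rankOne a b)) (qRad 1 (rankOne a b)) := by
  have hunit {v : H} (hv : v ≠ 0) : ‖(‖v‖⁻¹ : ℂ) • v‖ = 1 := norm_smul_inv_norm hv
  have hscale {v : H} (hv : v ≠ 0) : (‖v‖ : ℂ) • (‖v‖⁻¹ : ℂ) • v = v := by
    rw [smul_smul, mul_inv_cancel₀ (by simpa using hv), one_smul]
  have h := min_qRad_rankOne_le_of_norm_eq_one hdim (hunit ha) (hunit hb) hq
  rw [← hscale ha, ← hscale hb]
  simp only [qRad_rankOne_smul (norm_nonneg _) (norm_nonneg _)]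
  rw [ge_iff_le, ← mul_min_of_nonneg _ _ (by positivity)]
  exact mul_le_mul_of_nonneg_left h (by positivity)
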